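/- arXiv:0802.1231 — 7 statements merged into one kernel-verified Lean document; each statement's English description precedes it below -/
import Mathlib

section
/- Let n be an odd positive integer and d a positive integer. For every b ∈ ℤ^d, the eigenvalue λ_b = Σ_{x ∈ {0,...,n-1}^d, gcd(x_1²+...+x_d², n) = 1} e_n(b_1 x_1 + ... + b_d x_d) of the unitary finite-Euclidean graph is an integer, i.e., there exists m ∈ ℤ with λ_b = m. -/
open Finset

/-- `en n x = exp(2πi x / n)` -/
noncomputable def en (n : ℕ) (x : ℤ) : ℂ := Complex.exp (2 * Real.pi * Complex.I * x / n)

/-- The eigenvalue `λ_b = Σ_{x ∈ {0,…,n-1}^d, gcd(x·x, n) = 1} e_n(b·x)`. -/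
noncomputable def lamb (n d : ℕ) (b : Fin d → ℤ) : ℂ :=
  ∑ x ∈ (Fintype.piFinset fun _ : Fin d => Finset.Ico (0:ℤ) n) |>.filter
      (fun x => Int.gcd (∑ i, x i ^ 2) n = 1),
    en n (∑ i, b i * x i)

/-- A sum of `n`-th roots of unity which is unchanged when all exponents are multiplied by a
unit of `ZMod n` is an integer. -/
theorem exists_int_eq_sum_stdAddChar {n : ℕ} [NeZero n] {ι : Type*} (s : Finset ι)
    (f : ι → ZMod n)
    (h : ∀ u : (ZMod n)ˣ, ∑ i ∈ s, ZMod.stdAddChar ((u : ZMod n) * f i) = ∑ i ∈ s, ZMod.stdAddChar (f i)) :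
    ∃ m : ℤ, ∑ i ∈ s, ZMod.stdAddChar (f i) = m := by
  set ζ : ℂ := ZMod.stdAddChar (1 : ZMod n) with hζ_def
  have hpow (a : ZMod n) : ZMod.stdAddChar a = ζ ^ a.val := by
    rw [hζ_def, ← AddChar.map_nsmul_eq_pow, nsmul_one, ZMod.natCast_zmod_val]
  have hζ : IsPrimitiveRoot ζ n := by
    have := Complex.isPrimitiveRoot_exp n (NeZero.ne n)
    have h1 := ZMod.stdAddChar_coe (N := n) 1
    simp only [Int.cast_one, mul_one] at h1
    rwa [hζ_def, h1]
  let K := CyclotomicField n ℚ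
  have : IsCyclotomicExtension {n} ℚ K := CyclotomicField.isCyclotomicExtension n ℚ
  have : IsGalois ℚ K := IsCyclotomicExtension.isGalois {n} ℚ K
  have : FiniteDimensional ℚ K := IsCyclotomicExtension.finiteDimensional {n} ℚ K
  let φ : K →ₐ[ℚ] ℂ := IsAlgClosed.lift
  have hφ : Function.Injective φ := φ.injective
  obtain ⟨η, hη⟩ : ∃ η : K, φ η = ζ := by
    have hz := (IsCyclotomicExtension.zeta_spec n ℚ K).map_of_injective hφ
    obtain ⟨i, -, hi⟩ := hz.eq_pow_of_pow_eq_one hζ.pow_eq_one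
    exact ⟨IsCyclotomicExtension.zeta n ℚ K ^ i, by rw [map_pow, hi]⟩
  have hηp : IsPrimitiveRoot η n := .of_map_of_injective (hη ▸ hζ) hφ
  set S : K := ∑ i ∈ s, η ^ (f i).val with hS_def
  have hS : φ S = ∑ i ∈ s, ZMod.stdAddChar (f i) := by simp [S, hη, hpow]
  have hfix (σ : Gal(K/ℚ)) : σ S = S := by
    apply hφ
    rw [hS, ← h (hηp.autToPow ℚ σ), hS_def]
    simp only [map_sum, map_pow, ← hηp.autToPow_spec ℚ σ, hη]
    refine Finset.sum_congr rfl fun i _ => ?_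
    rw [← hpow, ← AddChar.map_nsmul_eq_pow, nsmul_eq_mul, ZMod.natCast_zmod_val, mul_comm]
  obtain ⟨q, hq⟩ := (IsGalois.mem_range_algebraMap_iff_fixed S).2 hfix
  have hint : IsIntegral ℤ S :=
    IsIntegral.sum _ fun i _ => (hηp.isIntegral (NeZero.pos n)).pow _
  have hqint : IsIntegral ℤ q :=
    (isIntegral_algebraMap_iff (algebraMap ℚ K).injective).1 (hq ▸ hint)
  obtain ⟨m, rfl⟩ := IsIntegrallyClosed.isIntegral_iff.1 hqint
  exact ⟨m, by rw [← hS, ← hq]; simp⟩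

theorem lamb_eq_sum_stdAddChar (n d : ℕ) [NeZero n] (b : Fin d → ℤ) :
    lamb n d b = ∑ x : Fin d → ZMod n with IsUnit (∑ i, x i ^ 2),
      ZMod.stdAddChar (∑ i, (b i : ZMod n) * x i) := by
  refine Finset.sum_bij' (fun x _ i => (x i : ZMod n)) (fun y _ i => ((y i).val : ℤ)) ?_ ?_ ?_ ?_ ?_
  · intro x hx
    have h2 := (Finset.mem_filter.1 hx).2
    have := (ZMod.coe_int_isUnit_iff_isCoprime (∑ i, x i ^ 2) n).2
      (Int.isCoprime_iff_gcd_eq_one.2 h2).symm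
    simpa using this
  · intro y hy
    have h2 : IsUnit (((∑ i, ((y i).val : ℤ) ^ 2 : ℤ)) : ZMod n) := by simpa using hy
    rw [ZMod.coe_int_isUnit_iff_isCoprime] at h2
    refine Finset.mem_filter.2 ⟨?_, Int.isCoprime_iff_gcd_eq_one.1 h2.symm⟩
    simp [-ZMod.natCast_val, ZMod.val_lt]
  · intro x hx
    have h1 := (Finset.mem_filter.1 hx).1
    ext i
    have h3 := Finset.mem_Ico.1 (Fintype.mem_piFinset.1 h1 i)
    rw [ZMod.val_intCast, Int.emod_eq_of_lt h3.1 h3.2]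
  · intro y hy
    ext i
    simp
  · intro x hx
    rw [en, ← ZMod.stdAddChar_coe]
    simp

/-- For `n` odd, every eigenvalue `λ_b` of the unitary finite-Euclidean graph is an integer. -/
theorem unitary_euclidean_integral_odd (n d : ℕ) (hn : 0 < n) (hodd : Odd n) (hd : 0 < d)
    (b : Fin d → ℤ) : ∃ m : ℤ, lamb n d b = m := by
  have : NeZero n := ⟨hn.ne'⟩
  rw [lamb_eq_sum_stdAddChar]
  refine exists_int_eq_sum_stdAddChar _ _ fun u => ?_
  have hq (v : (ZMod n)ˣ) (x : Fin d → ZMod n) (hx : IsUnit (∑ i, x i ^ 2)) :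
      IsUnit (∑ i, (v • x) i ^ 2) := by
    have : ∑ i, (v • x) i ^ 2 = (v : ZMod n) ^ 2 * ∑ i, x i ^ 2 := by
      simp [Finset.mul_sum, mul_pow, Units.smul_def]
    rw [this]
    exact (v.isUnit.pow 2).mul hx
  refine Finset.sum_bij' (fun x _ => u • x) (fun x _ => u⁻¹ • x) ?_ ?_ ?_ ?_ ?_
  · intro x hx
    exact Finset.mem_filter.2 ⟨Finset.mem_univ _, hq u x (Finset.mem_filter.1 hx).2⟩
  · intro x hx
    exact Finset.mem_filter.2 ⟨Finset.mem_univ _, hq u⁻¹ x (Finset.mem_filter.1 hx).2⟩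
  · intro x _
    exact inv_smul_smul u x
  · intro x _
    exact smul_inv_smul u x
  · intro x _
    congr 1
    simp [Finset.mul_sum, Units.smul_def, mul_left_comm]
end

section
/- Let n be a positive integer and d an even positive integer. For every b ∈ ℤ^d, the eigenvalue λ_b = Σ_{x ∈ {0,...,n-1}^d, gcd(x_1²+...+x_d², n) = 1} e_n(b_1 x_1 + ... + b_d x_d) of the unitary finite-Euclidean graph is an integer, i.e., there exists m ∈ ℤ with λ_b = m. -/
open Finset

/-- The sum of `ψ(b·x)` over the vectors `x` over `ℤ/n` for which `x·x` is a unit. -/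
def unitSphereCharSum {R : Type*} [CommRing R] {n d : ℕ} [NeZero n]
    (ψ : AddChar (ZMod n) R) (b : Fin d → ZMod n) : R :=
  ∑ x : {x : Fin d → ZMod n // IsUnit (∑ i, x i ^ 2)}, ψ (∑ i, b i * x.1 i)

theorem unitSphereCharSum_map {R S : Type*} [CommRing R] [CommRing S] {n d : ℕ} [NeZero n]
    (f : R →+* S) (ψ : AddChar (ZMod n) R) (b : Fin d → ZMod n) :
    f (unitSphereCharSum ψ b) = unitSphereCharSum (f.toMonoidHom.compAddChar ψ) b := by
  simp [unitSphereCharSum]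

/-- Scaling by a unit `t` preserves the set of vectors `x` with `x·x` a unit. -/
theorem unitSphereCharSum_mulShift {R : Type*} [CommRing R] {n d : ℕ} [NeZero n]
    (ψ : AddChar (ZMod n) R) (b : Fin d → ZMod n) (t : (ZMod n)ˣ) :
    unitSphereCharSum (AddChar.mulShift ψ t) b = unitSphereCharSum ψ b := by
  have key (u : (ZMod n)ˣ) (x : Fin d → ZMod n) (hx : IsUnit (∑ i, x i ^ 2)) :
      IsUnit (∑ i, (u * x i : ZMod n) ^ 2) := by
    simp_rw [mul_pow, ← Finset.mul_sum]
    exact (u.isUnit.pow 2).mul hx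
  refine Fintype.sum_equiv
    { toFun := fun x => ⟨fun i => t * x.1 i, key t _ x.2⟩
      invFun := fun x => ⟨fun i => (t⁻¹ : (ZMod n)ˣ) * x.1 i, key t⁻¹ _ x.2⟩
      left_inv := fun x => by ext; simp
      right_inv := fun x => by ext; simp } _ _ fun x => ?_
  simp [AddChar.mulShift_apply, Finset.mul_sum, mul_left_comm]

theorem isIntegral_unitSphereCharSum {R : Type*} [CommRing R] {n d : ℕ} [NeZero n]
    (ψ : AddChar (ZMod n) R) (b : Fin d → ZMod n) : IsIntegral ℤ (unitSphereCharSum ψ b) := by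
  refine IsIntegral.sum _ fun x _ => IsIntegral.of_pow (NeZero.pos n) ?_
  rw [← AddChar.map_nsmul_eq_pow]
  simp [isIntegral_one]

/-- Over a cyclotomic field the sum is fixed by the Galois group, so it is an integer. -/
theorem exists_int_eq_unitSphereCharSum {n d : ℕ} [NeZero n] {K : Type*} [Field K] [Algebra ℚ K]
    [IsCyclotomicExtension {n} ℚ K] {ζ : K} (hζ : IsPrimitiveRoot ζ n) (b : Fin d → ZMod n) :
    ∃ m : ℤ, unitSphereCharSum (AddChar.zmodChar n hζ.pow_eq_one) b = m := by
  have := IsCyclotomicExtension.finiteDimensional {n} ℚ K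
  have : IsGalois ℚ K := IsCyclotomicExtension.isGalois {n} ℚ K
  set ψ := AddChar.zmodChar n hζ.pow_eq_one
  have hfix (σ : K ≃ₐ[ℚ] K) : σ (unitSphereCharSum ψ b) = unitSphereCharSum ψ b := by
    obtain ⟨t, -, ht, hσ⟩ := hζ.isPrimitiveRoot_iff.mp (hζ.map_of_injective σ.injective)
    have hψ : (σ : _ →+* K).toMonoidHom.compAddChar ψ =
        AddChar.mulShift ψ (ZMod.unitOfCoprime t ht) := by
      ext k
      rw [AddChar.mulShift_apply, ZMod.coe_unitOfCoprime, ← nsmul_eq_mul,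
        AddChar.map_nsmul_eq_pow]
      simp [ψ, AddChar.zmodChar_apply, ← hσ, ← pow_mul, mul_comm]
    have := unitSphereCharSum_map (σ : _ →+* K) ψ b
    rwa [hψ, unitSphereCharSum_mulShift] at this
  obtain ⟨q, hq⟩ := IntermediateField.mem_bot.mp ((IsGalois.mem_bot_iff_fixed _).mpr hfix)
  have hint := isIntegral_unitSphereCharSum ψ b
  rw [← hq, isIntegral_algebraMap_iff (algebraMap ℚ _).injective,
    IsIntegrallyClosed.isIntegral_iff] at hint
  obtain ⟨m, rfl⟩ := hint
  exact ⟨m, by rw [← hq]; simp⟩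

theorem lamb_eq_unitSphereCharSum (n d : ℕ) [NeZero n] (b : Fin d → ℤ) :
    lamb n d b = unitSphereCharSum ZMod.stdAddChar (fun i => (b i : ZMod n)) := by
  classical
  have hgcd (x : Fin d → ℤ) :
      Int.gcd (∑ i, x i ^ 2) n = 1 ↔ IsUnit (∑ i, (x i : ZMod n) ^ 2) := by
    have := ZMod.coe_int_isUnit_iff_isCoprime (∑ i, x i ^ 2) n
    push_cast at this
    rw [this, ← Int.isCoprime_iff_gcd_eq_one, isCoprime_comm]
  rw [unitSphereCharSum, ← Finset.sum_subtype
    (univ.filter fun x : Fin d → ZMod n => IsUnit (∑ i, x i ^ 2)) (by simp)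
    (fun x => ZMod.stdAddChar (∑ i, (b i : ZMod n) * x i))]
  refine Finset.sum_bij' (fun x _ i => (x i : ZMod n)) (fun y _ i => ((y i).val : ℤ))
    ?_ ?_ ?_ ?_ ?_
  · intro x hx
    simpa [hgcd] using (Finset.mem_filter.mp hx).2
  · intro y hy
    have hy' := (Finset.mem_filter.mp hy).2
    rw [Finset.mem_filter, hgcd, Fintype.mem_piFinset]
    refine ⟨fun i => ?_, by simpa using hy'⟩
    exact Finset.mem_Ico.mpr ⟨by positivity, by exact_mod_cast ZMod.val_lt (y i)⟩
  · intro x hx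
    ext i
    have hi := Finset.mem_Ico.mp (Fintype.mem_piFinset.mp (Finset.mem_filter.mp hx).1 i)
    simp only [ZMod.val_intCast, Int.emod_eq_of_lt hi.1 hi.2]
  · intro y _
    ext i
    simp
  · intro x _
    have := ZMod.stdAddChar_coe (N := n) (∑ i, b i * x i)
    push_cast at this
    rw [this, en]
    push_cast
    rfl

theorem exists_int_eq_lamb (n d : ℕ) [NeZero n] (K : Type*) [Field K] [Algebra ℚ K]
    [IsCyclotomicExtension {n} ℚ K] (b : Fin d → ℤ) : ∃ m : ℤ, lamb n d b = m := by
  have := IsCyclotomicExtension.finiteDimensional {n} ℚ K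
  let f : K →ₐ[ℚ] ℂ := IsAlgClosed.lift
  have hζ := IsCyclotomicExtension.zeta_spec n ℚ K
  obtain ⟨t, -, -, ht⟩ := (hζ.map_of_injective f.injective).isPrimitiveRoot_iff.mp
    (Complex.isPrimitiveRoot_exp n (NeZero.ne n))
  rw [← map_pow] at ht
  have hζt := (ht ▸ Complex.isPrimitiveRoot_exp n (NeZero.ne n)).of_map_of_injective f.injective
  obtain ⟨m, hm⟩ := exists_int_eq_unitSphereCharSum hζt fun i => (b i : ZMod n)
  have hψ : (f : _ →+* ℂ).toMonoidHom.compAddChar (AddChar.zmodChar n hζt.pow_eq_one) =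
      ZMod.stdAddChar := by
    ext k
    have hk := ZMod.stdAddChar_coe (N := n) k.val
    simp only [Int.cast_natCast, ZMod.natCast_zmod_val] at hk
    rw [hk]
    simp only [MonoidHom.compAddChar_apply, Function.comp_apply, AddChar.zmodChar_apply]
    change f _ = _
    rw [map_pow, show f _ = _ from ht, ← Complex.exp_nat_mul]
    congr 1
    ring
  refine ⟨m, ?_⟩
  rw [lamb_eq_unitSphereCharSum, ← hψ, ← unitSphereCharSum_map, hm, map_intCast]

/-- For `d` even, every eigenvalue `λ_b` of the unitary finite-Euclidean graph is an integer. -/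
theorem unitary_euclidean_integral_even_dim (n d : ℕ) (hn : 0 < n) (hd : 0 < d) (hdeven : Even d)
    (b : Fin d → ℤ) : ∃ m : ℤ, lamb n d b = m := by
  have : NeZero n := ⟨hn.ne'⟩
  exact @exists_int_eq_lamb n d _ (CyclotomicField n ℚ) _ _
    (CyclotomicField.isCyclotomicExtension n ℚ) b
end

section
/- For every odd positive integer n and every integer c, the product G_n(1) · G_n(χ, c) is n times an integer, i.e., there exists m ∈ ℤ such that (Σ_{k=0}^{n-1} e_n(k²)) · (Σ_{k=0}^{n-1} (k|n) e_n(ck)) = n·m, where (k|n) denotes the Jacobi symbol. -/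
open Finset

/-- The Gauss sum `G_m(c) = Σ_{j=0}^{m-1} e_m(c j²)`. -/
noncomputable def gauss (m : ℕ) (c : ℤ) : ℂ := ∑ j ∈ Finset.range m, en m (c * j ^ 2)

/-- The Gauss character sum `G_n(χ, c) = Σ_{k=0}^{n-1} (k|n) e_n(ck)` with the Jacobi symbol. -/
noncomputable def gaussChi (n : ℕ) (c : ℤ) : ℂ :=
  ∑ k ∈ Finset.range n, (jacobiSym k n : ℂ) * en n (c * k)

theorem en_add (n : ℕ) (x y : ℤ) : en n (x + y) = en n x * en n y := by
  simp only [en, ← Complex.exp_add]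
  congr 1
  push_cast
  ring

theorem en_mul_mul_left {d : ℕ} (hd : d ≠ 0) (n : ℕ) (x : ℤ) : en (d * n) (d * x) = en n x := by
  have : (d : ℂ) ≠ 0 := by exact_mod_cast hd
  simp only [en]
  congr 1
  push_cast
  rw [mul_left_comm, mul_div_mul_left _ _ this]

theorem en_eq_stdAddChar (n : ℕ) [NeZero n] (x : ℤ) : en n x = ZMod.stdAddChar (x : ZMod n) := by
  rw [ZMod.stdAddChar_coe, en]

theorem en_congr {n : ℕ} (hn : n ≠ 0) {x y : ℤ} (h : (x : ZMod n) = y) : en n x = en n y := by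
  have : NeZero n := ⟨hn⟩
  rw [en_eq_stdAddChar, en_eq_stdAddChar, h]

theorem sum_range_natCast_zmod (n : ℕ) [NeZero n] {M : Type*} [AddCommMonoid M] (f : ZMod n → M) :
    ∑ k ∈ range n, f k = ∑ x, f x := by
  refine Finset.sum_bij' (fun k _ => (k : ZMod n)) (fun x _ => x.val) (by simp)
    (fun x _ => by simpa using x.val_lt) (fun k hk => ?_) (by simp) (by simp)
  exact ZMod.val_cast_of_lt (mem_range.1 hk)

theorem sum_range_coprime_mul {M : Type*} [AddCommMonoid M] {f : ℕ → M} {n a : ℕ} (hn : n ≠ 0)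
    (hf : Function.Periodic f n) (ha : a.Coprime n) :
    ∑ k ∈ range n, f (a * k) = ∑ k ∈ range n, f k := by
  have : NeZero n := ⟨hn⟩
  have hval (k : ℕ) : f k = f (k : ZMod n).val := by rw [ZMod.val_natCast, hf.map_mod_nat]
  rw [sum_congr rfl fun k _ => hval k, sum_congr rfl fun k _ => hval (a * k)]
  simp only [Nat.cast_mul]
  rw [sum_range_natCast_zmod n (fun x => f ((a : ZMod n) * x).val),
    sum_range_natCast_zmod n (fun x => f x.val)]
  exact Fintype.sum_bijective _ (ZMod.unitOfCoprime a ha).mulLeft_bijective _ _ fun _ => rfl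

theorem sum_range_mul_eq {M : Type*} [AddCommMonoid M] (f : ℕ → M) (a b : ℕ) :
    ∑ k ∈ range (a * b), f k = ∑ i ∈ range b, ∑ j ∈ range a, f (j + a * i) := by
  induction b with
  | zero => simp
  | succ b ih =>
    rw [mul_add_one, sum_range_add, ih, sum_range_succ]
    simp [add_comm]

theorem sum_en_mul {n : ℕ} (hn : n ≠ 0) (x : ℤ) :
    ∑ k ∈ range n, en n (k * x) = if (n : ℤ) ∣ x then (n : ℂ) else 0 := by
  have : NeZero n := ⟨hn⟩
  have h := AddChar.sum_mulShift (x : ZMod n) (ZMod.isPrimitive_stdAddChar n)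
  rw [← sum_range_natCast_zmod n] at h
  simp only [ZMod.card, ZMod.intCast_zmod_eq_zero_iff_dvd] at h
  simpa [en_eq_stdAddChar] using h

theorem gauss_mul_mul_left {d m : ℕ} (hd : d ≠ 0) (hm : m ≠ 0) (c : ℤ) :
    gauss (d * m) (d * c) = d * gauss m c := by
  simp only [gauss, mul_assoc, en_mul_mul_left hd]
  rw [mul_comm d m, sum_range_mul_eq]
  have h (i j : ℕ) : en m (c * ((j + m * i : ℕ) : ℤ) ^ 2) = en m (c * (j : ℤ) ^ 2) :=
    en_congr hm (by push_cast; simp)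
  simp only [h, sum_const, card_range, nsmul_eq_mul]

theorem gauss_mul_of_coprime {m p : ℕ} (hm : m ≠ 0) (hp : p ≠ 0) (h : p.Coprime m) (c : ℤ) :
    gauss (m * p) c = gauss p (c * m) * gauss m (c * p) := by
  have hmp : m * p ≠ 0 := mul_ne_zero hm hp
  set F : ℕ → ℂ := fun j => ∑ i ∈ range p, en (m * p) (c * ((j + m * i : ℕ) : ℤ) ^ 2) with hF
  have hper : Function.Periodic F m := by
    intro j
    have hlast : en (m * p) (c * ((j + m * p : ℕ) : ℤ) ^ 2) =
        en (m * p) (c * ((j + m * 0 : ℕ) : ℤ) ^ 2) := by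
      refine en_congr hmp ?_
      have : ((m : ZMod (m * p)) * p) = 0 := by exact_mod_cast ZMod.natCast_self (m * p)
      push_cast
      simp [this]
    have h1 := sum_range_succ (fun i => en (m * p) (c * ((j + m * i : ℕ) : ℤ) ^ 2)) p
    rw [sum_range_succ', hlast, add_left_inj] at h1
    simp only [hF]
    rw [← h1]
    refine sum_congr rfl fun i _ => ?_
    congr 3
    push_cast
    ring
  have hsplit (i j : ℕ) : en (m * p) (c * ((p * j + m * i : ℕ) : ℤ) ^ 2) =
      en m (c * p * (j : ℤ) ^ 2) * en p (c * m * (i : ℤ) ^ 2) := by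
    rw [← en_mul_mul_left hm p, ← en_mul_mul_left hp m, mul_comm p m, ← en_add]
    refine en_congr hmp ?_
    have : ((m : ZMod (m * p)) * p) = 0 := by exact_mod_cast ZMod.natCast_self (m * p)
    push_cast
    linear_combination (2 * c * i * j : ZMod (m * p)) * this
  rw [gauss, sum_range_mul_eq, sum_comm]
  change ∑ j ∈ range m, F j = _
  rw [← sum_range_coprime_mul hm hper h]
  simp only [hF, hsplit, ← mul_sum, ← sum_mul, gauss]
  rw [mul_comm]

theorem gauss_sq_mul {p m : ℕ} (hp : p.Prime) (hp2 : p ≠ 2) (hm : m ≠ 0) {c : ℤ}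
    (hc : IsCoprime c p) : gauss (m * p * p) c = p * gauss m c := by
  have hp0 := hp.ne_zero
  have hpI : Prime (p : ℤ) := Nat.prime_iff_prime_int.1 hp
  have hn : m * p * p ≠ 0 := by positivity
  have hsplit (i j : ℕ) : en (m * p * p) (c * ((j + m * p * i : ℕ) : ℤ) ^ 2) =
      en (m * p * p) (c * (j : ℤ) ^ 2) * en p (i * (2 * c * j)) := by
    rw [← en_mul_mul_left (mul_ne_zero hm hp0) p, ← en_add]
    refine en_congr hn ?_
    have : ((m : ZMod (m * p * p)) * p * p) = 0 := by exact_mod_cast ZMod.natCast_self (m * p * p)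
    push_cast
    linear_combination (c * i ^ 2 * m : ZMod (m * p * p)) * this
  have hdvd (j : ℕ) : (p : ℤ) ∣ 2 * c * j ↔ p ∣ j := by
    constructor
    · intro h
      have h2 : ¬ (p : ℤ) ∣ 2 := fun h =>
        hp2 ((Nat.prime_dvd_prime_iff_eq hp Nat.prime_two).1 (by exact_mod_cast h))
      have hc' : ¬ (p : ℤ) ∣ c := fun h => hpI.not_isUnit (hc.isUnit_of_dvd' h dvd_rfl)
      rcases hpI.dvd_or_dvd h with h | h
      · exact ((hpI.dvd_or_dvd h).elim h2 hc').elim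
      · exact_mod_cast h
    · exact fun h => Dvd.dvd.mul_left (by exact_mod_cast h) _
  rw [gauss, sum_range_mul_eq, sum_comm]
  simp only [hsplit, ← mul_sum, sum_en_mul hp0, hdvd]
  rw [mul_comm m p, sum_range_mul_eq, gauss, mul_sum]
  refine sum_congr rfl fun i _ => ?_
  rw [sum_eq_single_of_mem 0 (mem_range.2 hp.pos)]
  · rw [if_pos (by simp), mul_comm, ← en_mul_mul_left (mul_ne_zero hp0 hp0) m]
    congr 2
    · ring
    · push_cast
      ring
  · intro j hj hj0
    rw [if_neg, mul_zero]
    rw [Nat.dvd_add_left (dvd_mul_right p i)]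
    exact Nat.not_dvd_of_pos_of_lt (Nat.pos_of_ne_zero hj0) (mem_range.1 hj)

theorem intCast_zmod_ne_zero_of_isCoprime {p : ℕ} [Fact p.Prime] {c : ℤ} (hc : IsCoprime c p) :
    (c : ZMod p) ≠ 0 := by
  rw [Ne, ZMod.intCast_zmod_eq_zero_iff_dvd]
  exact fun h => (Nat.prime_iff_prime_int.1 (Fact.out : p.Prime)).not_isUnit
    (hc.isUnit_of_dvd' h dvd_rfl)

theorem gauss_prime_eq_gaussSum (p : ℕ) [Fact p.Prime] (hp2 : p ≠ 2) {c : ℤ}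
    (hc : IsCoprime c p) :
    gauss p c = ∑ x : ZMod p, (quadraticChar (ZMod p) x : ℂ) * ZMod.stdAddChar ((c : ZMod p) * x) := by
  have hc0 := intCast_zmod_ne_zero_of_isCoprime hc
  have h0 := AddChar.sum_mulShift (c : ZMod p) (ZMod.isPrimitive_stdAddChar p)
  rw [if_neg hc0] at h0
  have hsq : gauss p c = ∑ x : ZMod p, (ZMod.stdAddChar ((c : ZMod p) * x ^ 2) : ℂ) := by
    rw [← sum_range_natCast_zmod p]
    simp [gauss, en_eq_stdAddChar]
  rw [hsq, ← sum_fiberwise univ (fun x : ZMod p => x ^ 2)]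
  have hfib (y : ZMod p) : ∑ x with x ^ 2 = y, (ZMod.stdAddChar ((c : ZMod p) * x ^ 2) : ℂ) =
      (quadraticChar (ZMod p) y : ℂ) * ZMod.stdAddChar ((c : ZMod p) * y) +
        ZMod.stdAddChar (y * (c : ZMod p)) := by
    have hcard := quadraticChar_card_sqrts (F := ZMod p) (by rwa [ZMod.ringChar_zmod_n]) y
    have hcard' : ((#{x : ZMod p | x ^ 2 = y} : ℕ) : ℂ) = quadraticChar (ZMod p) y + 1 := by
      rw [Set.toFinset_ofPred] at hcard
      exact_mod_cast congrArg (Int.cast : ℤ → ℂ) hcard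
    rw [sum_congr rfl (g := fun _ => (ZMod.stdAddChar ((c : ZMod p) * y) : ℂ))
      fun x hx => by rw [(mem_filter.1 hx).2], sum_const, nsmul_eq_mul, hcard', mul_comm y]
    ring
  rw [sum_congr rfl fun y _ => hfib y, sum_add_distrib, h0]
  simp

theorem gauss_prime (p : ℕ) [Fact p.Prime] (hp2 : p ≠ 2) {c : ℤ} (hc : IsCoprime c p) :
    gauss p c = jacobiSym c p * gauss p 1 := by
  have hc0 := intCast_zmod_ne_zero_of_isCoprime hc
  rw [gauss_prime_eq_gaussSum p hp2 hc, gauss_prime_eq_gaussSum p hp2 isCoprime_one_left,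
    ← jacobiSym.legendreSym.to_jacobiSym, legendreSym, mul_sum]
  refine Fintype.sum_bijective _ (mulLeft_bijective₀ _ hc0) _ _ fun x => ?_
  have hsq : (quadraticChar (ZMod p) c : ℂ) ^ 2 = 1 := by
    exact_mod_cast congrArg (Int.cast : ℤ → ℂ) (quadraticChar_sq_one hc0)
  simp only [map_mul, Int.cast_mul, Int.cast_one, one_mul]
  linear_combination (-(quadraticChar (ZMod p) x : ℂ) * ZMod.stdAddChar ((c : ZMod p) * x)) * hsq

theorem gauss_eq_jacobiSym_mul {n : ℕ} (hodd : Odd n) {c : ℤ} (hc : IsCoprime c n) :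
    gauss n c = jacobiSym c n * gauss n 1 := by
  induction n using Nat.strong_induction_on generalizing c with
  | _ n ih =>
  rcases eq_or_ne n 1 with rfl | hn1
  · simp [gauss, en]
  obtain ⟨p, hp, m, rfl⟩ := Nat.exists_prime_and_dvd hn1
  have : Fact p.Prime := ⟨hp⟩
  obtain ⟨hop, hom⟩ := Nat.odd_mul.1 hodd
  have hp2 : p ≠ 2 := by rintro rfl; exact absurd hop (by decide)
  have hp0 := hp.ne_zero
  have hm0 : m ≠ 0 := hom.pos.ne'
  rw [Nat.cast_mul] at hc
  have hcp : IsCoprime c p := hc.of_mul_right_left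
  have hcm : IsCoprime c m := hc.of_mul_right_right
  by_cases hpm : p ∣ m
  · obtain ⟨l, rfl⟩ := hpm
    have hol := (Nat.odd_mul.1 hom).2
    have hl0 : l ≠ 0 := hol.pos.ne'
    have hcl : IsCoprime c l := by
      rw [Nat.cast_mul] at hcm
      exact hcm.of_mul_right_right
    have hlt : l < p * (p * l) := by
      rw [← mul_assoc]
      exact lt_mul_of_one_lt_left (Nat.pos_of_ne_zero hl0) (one_lt_mul'' hp.one_lt hp.one_lt)
    have hJ : jacobiSym c p * jacobiSym c p = 1 := by
      rcases jacobiSym.eq_one_or_neg_one (Int.isCoprime_iff_gcd_eq_one.1 hcp) with h | h <;>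
        simp [h]
    rw [jacobiSym.mul_right' c hp0 hm0, jacobiSym.mul_right' c hp0 hl0, ← mul_assoc (jacobiSym c p),
      hJ, one_mul, show p * (p * l) = l * p * p by ring, gauss_sq_mul hp hp2 hl0 hcp,
      gauss_sq_mul hp hp2 hl0 isCoprime_one_left, ih l hlt hol hcl]
    ring
  · have hcop : p.Coprime m := (hp.coprime_iff_not_dvd).2 hpm
    have hpmI : IsCoprime (p : ℤ) m := hcop.isCoprime
    have hlt : m < p * m := lt_mul_of_one_lt_left (Nat.pos_of_ne_zero hm0) hp.one_lt
    rw [jacobiSym.mul_right' c hp0 hm0, mul_comm p m, gauss_mul_of_coprime hm0 hp0 hcop,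
      gauss_mul_of_coprime hm0 hp0 hcop, one_mul, one_mul,
      gauss_prime p hp2 (hcp.mul_left hpmI.symm), gauss_prime p hp2 hpmI.symm,
      ih m hlt hom (hcm.mul_left hpmI), ih m hlt hom hpmI, jacobiSym.mul_left, jacobiSym.mul_left]
    push_cast
    ring

theorem sum_gauss_mul_en {n : ℕ} (hn : n ≠ 0) (c : ℤ) :
    ∑ k ∈ range n, gauss n k * en n (c * k) = n * #{j ∈ range n | (n : ℤ) ∣ ((j : ℕ) : ℤ) ^ 2 + c} := by
  have h (j k : ℕ) : en n (k * (j : ℤ) ^ 2) * en n (c * k) = en n (k * ((j : ℤ) ^ 2 + c)) := by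
    rw [← en_add]
    congr 1
    ring
  simp only [gauss, sum_mul]
  rw [sum_comm]
  simp only [h, sum_en_mul hn]
  rw [← sum_filter, sum_const, nsmul_eq_mul, mul_comm]

theorem sum_gauss_mul_en_gcd_eq {d m : ℕ} (hd : d ≠ 0) (hm : m ≠ 0) (c : ℤ) :
    ∑ k ∈ range (d * m) with (d * m).gcd k = d, gauss (d * m) k * en (d * m) (c * k) =
      d * ∑ k ∈ range m with m.gcd k = 1, gauss m k * en m (c * k) := by
  have hd' := Nat.pos_of_ne_zero hd
  rw [mul_sum]
  symm
  refine sum_bij (fun k _ => d * k) ?_ ?_ ?_ ?_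
  · intro k hk
    simp only [mem_filter, mem_range] at hk ⊢
    exact ⟨Nat.mul_lt_mul_of_pos_left hk.1 hd', by rw [Nat.gcd_mul_left, hk.2, mul_one]⟩
  · intro a _ b _ hab
    exact Nat.eq_of_mul_eq_mul_left hd' hab
  · intro k hk
    simp only [mem_filter, mem_range] at hk
    obtain ⟨l, rfl⟩ : d ∣ k := hk.2 ▸ Nat.gcd_dvd_right (d * m) k
    refine ⟨l, ?_, rfl⟩
    rw [Nat.gcd_mul_left] at hk
    simp only [mem_filter, mem_range]
    exact ⟨Nat.lt_of_mul_lt_mul_left hk.1, Nat.eq_of_mul_eq_mul_left hd' (by rw [hk.2, mul_one])⟩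
  · intro k _
    push_cast
    rw [gauss_mul_mul_left hd hm, mul_left_comm c, en_mul_mul_left hd, mul_assoc]

theorem exists_sum_coprime_gauss_mul_en_eq {n : ℕ} (hn : n ≠ 0) (c : ℤ) :
    ∃ m : ℤ, ∑ k ∈ range n with n.gcd k = 1, gauss n k * en n (c * k) = n * m := by
  induction n using Nat.strong_induction_on with
  | _ n ih =>
  have htot := sum_gauss_mul_en hn c
  rw [← sum_fiberwise_of_maps_to (t := n.divisors) (g := fun k => n.gcd k)
    (fun k _ => Nat.mem_divisors.2 ⟨Nat.gcd_dvd_left n k, hn⟩),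
    ← add_sum_erase _ _ (Nat.one_mem_divisors.2 hn)] at htot
  have hproper : ∀ d ∈ n.divisors.erase 1, ∃ m : ℤ,
      ∑ k ∈ range n with n.gcd k = d, gauss n k * en n (c * k) = n * m := by
    intro d hd
    rw [mem_erase, Nat.mem_divisors] at hd
    obtain ⟨hd1, ⟨m, rfl⟩, -⟩ := hd
    obtain ⟨hd0, hm0⟩ := mul_ne_zero_iff.1 hn
    have hlt : m < d * m := lt_mul_of_one_lt_left (Nat.pos_of_ne_zero hm0) (by omega)
    obtain ⟨t, ht⟩ := ih m hlt hm0
    refine ⟨t, ?_⟩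
    rw [sum_gauss_mul_en_gcd_eq hd0 hm0, ht]
    push_cast
    ring
  choose! t ht using hproper
  rw [sum_congr rfl ht, ← mul_sum] at htot
  refine ⟨#{j ∈ range n | (n : ℤ) ∣ ((j : ℕ) : ℤ) ^ 2 + c} - ∑ d ∈ n.divisors.erase 1, t d, ?_⟩
  push_cast
  linear_combination htot

theorem gauss_mul_gaussChi_eq_sum {n : ℕ} (hodd : Odd n) (c : ℤ) :
    gauss n 1 * gaussChi n c =
      ∑ k ∈ range n with n.gcd k = 1, gauss n k * en n (c * k) := by
  rw [gaussChi, mul_sum, sum_filter]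
  refine sum_congr rfl fun k _ => ?_
  split_ifs with h
  · rw [gauss_eq_jacobiSym_mul hodd (Nat.Coprime.isCoprime (Nat.Coprime.symm h))]
    ring
  · rw [jacobiSym.eq_zero_iff.2 ⟨hodd.pos.ne', by rwa [Int.gcd_natCast_natCast, Nat.gcd_comm]⟩]
    simp

/-- For `n` odd, `n ∣ G_n(1) · G_n(χ, c)`. -/
theorem gauss_mul_gaussChi_div (n : ℕ) (hn : 0 < n) (hodd : Odd n) (c : ℤ) :
    ∃ m : ℤ, gauss n 1 * gaussChi n c = n * m := by
  rw [gauss_mul_gaussChi_eq_sum hodd]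
  exact exists_sum_coprime_gauss_mul_en_eq hn.ne' c
end

section
/- Let n be a squarefree even positive integer, d a positive integer, and b ∈ ℤ^d. If there exists an index i with b_i even, then g_n(b) = Σ_{0 ≤ k < n, gcd(k,n)=1} Σ_{x ∈ {0,...,n-1}^d} e_n(b·x + k(x·x)) = 0. -/
open Finset

/-- `g_n(b) = Σ_{0 ≤ k < n, gcd(k,n)=1} Σ_{x ∈ {0,…,n-1}^d} e_n(b·x + k(x·x))`. -/
noncomputable def gsum (n d : ℕ) (b : Fin d → ℤ) : ℂ :=
  ∑ k ∈ (Finset.range n).filter (fun k => Nat.gcd k n = 1),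
    ∑ x ∈ Fintype.piFinset fun _ : Fin d => Finset.Ico (0:ℤ) n,
      en n (∑ i, b i * x i + k * ∑ i, x i ^ 2)

theorem en_add_mul_odd {m : ℕ} (hm : 0 < m) (a : ℤ) {c : ℤ} (hc : Odd c) :
    en (m + m) (a + m * c) = -en (m + m) a := by
  obtain ⟨t, rfl⟩ := hc
  have hm' : (m : ℂ) ≠ 0 := by exact_mod_cast hm.ne'
  have hm2 : (m : ℂ) + m ≠ 0 := by exact_mod_cast (by omega : m + m ≠ 0)
  have key : 2 * (Real.pi : ℂ) * Complex.I * ((a + m * (2 * t + 1) : ℤ) : ℂ) / ((m + m : ℕ) : ℂ)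
      = 2 * Real.pi * Complex.I * a / ((m + m : ℕ) : ℂ) + Real.pi * Complex.I
        + t * (2 * Real.pi * Complex.I) := by
    push_cast
    field_simp
    ring
  rw [en, en, key, Complex.exp_add, Complex.exp_add, Complex.exp_pi_mul_I,
    Complex.exp_int_mul_two_pi_mul_I]
  ring

theorem sum_apply_update {ι α β : Type*} [Fintype ι] [DecidableEq ι] [AddCommGroup β]
    (f : ι → α → β) (x : ι → α) (i : ι) (y : α) :
    ∑ j, f j (Function.update x i y j) = ∑ j, f j (x j) + (f i y - f i (x i)) := by
  rw [← Finset.add_sum_erase univ _ (mem_univ i), ← Finset.add_sum_erase univ (fun j => f j (x j))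
    (mem_univ i), Finset.sum_congr rfl fun j hj => by
      rw [Function.update_of_ne (Finset.ne_of_mem_erase hj)]]
  simp only [Function.update_self]
  abel

/-- For `n` squarefree even, if some coordinate of `b` is even then `g_n(b) = 0`. -/
theorem gsum_eq_zero_of_even_coord (n d : ℕ) (hn : 0 < n) (hsf : Squarefree n) (hev : Even n)
    (hd : 0 < d) (b : Fin d → ℤ) (hb : ∃ i, Even (b i)) :
    gsum n d b = 0 := by
  obtain ⟨m, rfl⟩ := hev
  obtain ⟨i, hi⟩ := hb
  have hm : 0 < m := by omega
  have hmodd : Odd m := by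
    by_contra h
    obtain ⟨t, rfl⟩ := Nat.not_odd_iff_even.mp h
    have := hsf 2 ⟨t, by ring⟩
    simp at this
  refine Finset.sum_eq_zero fun k hk => ?_
  have hkodd : Odd k := by
    by_contra h
    have h2 : 2 ∣ Nat.gcd k (m + m) :=
      Nat.dvd_gcd (Nat.not_odd_iff_even.mp h).two_dvd ⟨m, by ring⟩
    rw [(Finset.mem_filter.mp hk).2] at h2
    omega
  refine Finset.sum_involution
    (fun x _ => Function.update x i (if x i < m then x i + m else x i - m)) ?_ ?_ ?_ ?_
  · intro x _
    obtain ⟨ε, hε, hy⟩ : ∃ ε : ℤ, Odd ε ∧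
        (if x i < m then x i + m else x i - m) = x i + m * ε := by
      split_ifs
      · exact ⟨1, odd_one, by ring⟩
      · exact ⟨-1, odd_neg_one, by ring⟩
    rw [hy, sum_apply_update (fun j z => b j * z), sum_apply_update (fun _ z => z ^ 2)]
    have hodd : Odd (b i * ε + (k * (2 * x i * ε) + k * m * ε ^ 2)) := by
      refine (hi.mul_right ε).add_odd (Even.add_odd ⟨k * (x i * ε), by ring⟩ ?_)
      exact ((Int.odd_coe_nat k |>.mpr hkodd).mul (Int.odd_coe_nat m |>.mpr hmodd)).mul hε.pow
    rw [← add_neg_cancel (en (m + m) (∑ j, b j * x j + k * ∑ j, x j ^ 2)),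
      ← en_add_mul_odd hm _ hodd]
    congr 2
    ring
  · intro x _ _ h
    have := congrFun h i
    simp only [Function.update_self] at this
    split_ifs at this <;> omega
  · intro x hx
    rw [Fintype.mem_piFinset] at hx ⊢
    intro j
    rcases eq_or_ne j i with rfl | hj
    · have := Finset.mem_Ico.mp (hx j)
      rw [Function.update_self, Finset.mem_Ico]
      push_cast at this ⊢
      split_ifs <;> omega
    · rw [Function.update_of_ne hj]
      exact hx j
  · intro x hx
    have := Finset.mem_Ico.mp (Fintype.mem_piFinset.mp hx i)
    push_cast at this
    simp only [Function.update_self, Function.update_idem]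
    rw [Function.update_eq_self_iff]
    split_ifs <;> omega
end

section
/- Let n be a squarefree even positive integer, d an even positive integer, and b ∈ ℤ^d. Then g_n(b) = Σ_{0 ≤ k < n, gcd(k,n)=1} Σ_{x ∈ {0,...,n-1}^d} e_n(b·x + k(x·x)) is n times an integer, i.e., there exists m ∈ ℤ with g_n(b) = n·m. -/
open Finset

open scoped Classical in
/-- The sum `∑_{k ∈ Rˣ} ∑_{x ∈ R^d} ψ (b · x + k (x · x))` over a finite commutative ring `R`. -/
noncomputable def quadSum {R : Type} [CommRing R] [Fintype R] (ψ : AddChar R ℂ) {d : ℕ}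
    (b : Fin d → R) : ℂ :=
  ∑ k : R with IsUnit k, ∑ x : Fin d → R, ψ (∑ i, b i * x i + k * ∑ i, x i ^ 2)

section Field

variable {F : Type} [Field F] [Fintype F] [DecidableEq F] {ψ : AddChar F ℂ} {d : ℕ}

theorem sum_linear_eq_card_mul_int (hψ : ψ.IsPrimitive) (hd : 0 < d) (b : Fin d → F) :
    ∃ m : ℤ, ∑ x : Fin d → F, ψ (∑ i, b i * x i) = Fintype.card F * m := by
  have h : ∑ x : Fin d → F, ψ (∑ i, b i * x i)
      = ((∏ i, if b i = 0 then (Fintype.card F : ℤ) else 0 : ℤ) : ℂ) := by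
    have hprod : ∀ f : Fin d → F, ψ (∑ i, f i) = ∏ i, ψ (f i) := fun f =>
      map_prod ψ.toMonoidHom (fun i => Multiplicative.ofAdd (f i)) univ
    simp_rw [hprod]
    rw [← Fintype.piFinset_univ, ← Finset.prod_univ_sum (fun _ => univ) (fun i y => ψ (b i * y))]
    push_cast
    refine Finset.prod_congr rfl fun i _ => ?_
    simpa [mul_comm] using AddChar.sum_mulShift (b i) hψ
  have hdvd : (Fintype.card F : ℤ) ∣ ∏ i, if b i = 0 then (Fintype.card F : ℤ) else 0 := by
    refine dvd_trans ?_ (Finset.dvd_prod_of_mem _ (Finset.mem_univ (⟨0, hd⟩ : Fin d)))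
    split_ifs <;> simp
  obtain ⟨m, hm⟩ := hdvd
  exact ⟨m, by rw [h, hm]; push_cast; rfl⟩

theorem card_cone_fiber_eq (b : Fin d → F) {v : F} (hv : v ≠ 0) :
    #{x : Fin d → F | ∑ i, x i ^ 2 = 0 ∧ ∑ i, b i * x i = v}
      = #{x : Fin d → F | ∑ i, x i ^ 2 = 0 ∧ ∑ i, b i * x i = 1} := by
  have hsq : ∀ (c : F) (x : Fin d → F), ∑ i, (c • x) i ^ 2 = c ^ 2 * ∑ i, x i ^ 2 := by
    intro c x
    simp [Finset.mul_sum, mul_pow]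
  have hlin : ∀ (c : F) (x : Fin d → F), ∑ i, b i * (c • x) i = c * ∑ i, b i * x i := by
    intro c x
    simp [Finset.mul_sum, mul_left_comm]
  refine Finset.card_nbij' (fun x => v⁻¹ • x) (fun x => v • x) ?_ ?_ ?_ ?_
  · intro x hx
    simp only [coe_filter, mem_univ, true_and, Set.mem_ofPred_eq] at hx ⊢
    rw [hsq, hlin, hx.1, hx.2]
    simp [hv]
  · intro x hx
    simp only [coe_filter, mem_univ, true_and, Set.mem_ofPred_eq] at hx ⊢
    rw [hsq, hlin, hx.1, hx.2]
    simp
  · intro x _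
    simp [smul_smul, hv]
  · intro x _
    simp [smul_smul, hv]

theorem sum_cone_eq_int (hψ : ψ.IsPrimitive) (b : Fin d → F) :
    ∃ m : ℤ, ∑ x : Fin d → F with ∑ i, x i ^ 2 = 0, ψ (∑ i, b i * x i) = m := by
  set N : F → ℕ := fun v => #{x : Fin d → F | ∑ i, x i ^ 2 = 0 ∧ ∑ i, b i * x i = v} with hN
  have h1 : ∑ x : Fin d → F with ∑ i, x i ^ 2 = 0, ψ (∑ i, b i * x i) = ∑ v, N v * ψ v := by
    rw [← Finset.sum_fiberwise _ (fun x : Fin d → F => ∑ i, b i * x i)]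
    refine Finset.sum_congr rfl fun v _ => ?_
    rw [Finset.filter_filter, Finset.sum_congr rfl
      (fun x hx => by rw [(Finset.mem_filter.mp hx).2.2] : ∀ x ∈ _, _ = ψ v)]
    simp [hN]
  have h2 : ∑ v, ψ v = 0 := by
    refine AddChar.sum_eq_zero_of_ne_one ?_
    simpa using hψ one_ne_zero
  have h3 : ∑ v, (N v : ℂ) * ψ v
      = ∑ v, ((N 1 : ℂ) * ψ v + if v = 0 then (N 0 - N 1 : ℂ) else 0) := by
    refine Finset.sum_congr rfl fun v _ => ?_
    split_ifs with hv
    · simp [hv]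
    · simp only [hN]
      rw [card_cone_fiber_eq b hv, add_zero]
  refine ⟨N 0 - N 1, ?_⟩
  rw [h1, h3, Finset.sum_add_distrib, ← Finset.mul_sum, h2]
  simp

theorem quadSum_field (hψ : ψ.IsPrimitive) (hd : 0 < d) (b : Fin d → F) :
    ∃ m : ℤ, quadSum ψ b = Fintype.card F * m := by
  obtain ⟨m₀, h₀⟩ := sum_linear_eq_card_mul_int hψ hd b
  obtain ⟨m₁, h₁⟩ := sum_cone_eq_int hψ b
  have hall : ∑ k : F, ∑ x : Fin d → F, ψ (∑ i, b i * x i + k * ∑ i, x i ^ 2)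
      = Fintype.card F * m₁ := by
    rw [Finset.sum_comm, ← h₁, Finset.mul_sum, Finset.sum_filter]
    refine Finset.sum_congr rfl fun x _ => ?_
    simp_rw [AddChar.map_add_eq_mul]
    rw [← Finset.mul_sum, AddChar.sum_mulShift _ hψ]
    split_ifs <;> simp [mul_comm]
  refine ⟨m₁ - m₀, ?_⟩
  have hs := Finset.sum_filter_add_sum_filter_not univ (fun k : F => k = 0)
    (fun k => ∑ x : Fin d → F, ψ (∑ i, b i * x i + k * ∑ i, x i ^ 2))
  rw [hall, Finset.filter_eq' univ (0 : F)] at hs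
  simp only [mem_univ, if_true, sum_singleton, zero_mul, add_zero, h₀] at hs
  simp only [quadSum, isUnit_iff_ne_zero]
  push_cast
  rw [mul_sub, ← hs]
  simp

end Field

section Prod

variable {R S T : Type} [CommRing R] [CommRing S] [CommRing T]

/-- The restriction of an additive character of `R ≃+* S × T` to the first factor. -/
def AddChar.fstFactor (e : R ≃+* S × T) (ψ : AddChar R ℂ) : AddChar S ℂ :=
  ψ.compAddMonoidHom ((e.symm : S × T →+ R).comp (AddMonoidHom.inl S T))

/-- The restriction of an additive character of `R ≃+* S × T` to the second factor. -/
def AddChar.sndFactor (e : R ≃+* S × T) (ψ : AddChar R ℂ) : AddChar T ℂ :=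
  ψ.compAddMonoidHom ((e.symm : S × T →+ R).comp (AddMonoidHom.inr S T))

theorem AddChar.fstFactor_apply (e : R ≃+* S × T) (ψ : AddChar R ℂ) (s : S) :
    ψ.fstFactor e s = ψ (e.symm (s, 0)) := rfl

theorem AddChar.sndFactor_apply (e : R ≃+* S × T) (ψ : AddChar R ℂ) (t : T) :
    ψ.sndFactor e t = ψ (e.symm (0, t)) := rfl

theorem AddChar.eq_fstFactor_mul_sndFactor (e : R ≃+* S × T) (ψ : AddChar R ℂ) (r : R) :
    ψ r = ψ.fstFactor e (e r).1 * ψ.sndFactor e (e r).2 := by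
  rw [fstFactor_apply, sndFactor_apply, ← AddChar.map_add_eq_mul, ← map_add]
  simp

theorem AddChar.IsPrimitive.fstFactor (e : R ≃+* S × T) {ψ : AddChar R ℂ} (hψ : ψ.IsPrimitive) :
    (ψ.fstFactor e).IsPrimitive := by
  intro a ha h
  refine hψ (a := e.symm (a, 0)) (by simpa using ha) ?_
  ext r
  have := DFunLike.congr_fun h (e r).1
  rw [AddChar.mulShift_apply, AddChar.fstFactor_apply] at this
  rw [AddChar.mulShift_apply, ← e.symm_apply_apply r, ← map_mul]
  simpa only [Prod.mk_mul_mk, zero_mul, AddChar.one_apply, Prod.mul_def] using this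

theorem AddChar.IsPrimitive.sndFactor (e : R ≃+* S × T) {ψ : AddChar R ℂ} (hψ : ψ.IsPrimitive) :
    (ψ.sndFactor e).IsPrimitive := by
  intro a ha h
  refine hψ (a := e.symm (0, a)) (by simpa using ha) ?_
  ext r
  have := DFunLike.congr_fun h (e r).2
  rw [AddChar.mulShift_apply, AddChar.sndFactor_apply] at this
  rw [AddChar.mulShift_apply, ← e.symm_apply_apply r, ← map_mul]
  simpa only [Prod.mk_mul_mk, zero_mul, AddChar.one_apply, Prod.mul_def] using this

theorem quadSum_eq_mul [Fintype R] [Fintype S] [Fintype T] (e : R ≃+* S × T) (ψ : AddChar R ℂ)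
    {d : ℕ} (b : Fin d → R) :
    quadSum ψ b = quadSum (ψ.fstFactor e) (fun i => (e (b i)).1)
      * quadSum (ψ.sndFactor e) (fun i => (e (b i)).2) := by
  classical
  simp only [quadSum, Finset.sum_filter]
  rw [Fintype.sum_mul_sum, ← Fintype.sum_prod_type']
  refine Fintype.sum_equiv e.toEquiv _ _ fun k => ?_
  have hk : IsUnit k ↔ IsUnit (e k).1 ∧ IsUnit (e k).2 := by
    rw [← Prod.isUnit_iff, MulEquiv.isUnit_map]
  simp only [hk, RingEquiv.toEquiv_eq_coe, EquivLike.coe_coe, ite_zero_mul_ite_zero]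
  congr 1
  rw [Fintype.sum_mul_sum, ← Fintype.sum_prod_type']
  refine Fintype.sum_equiv ((Equiv.arrowCongr (Equiv.refl _) e.toEquiv).trans
    (Equiv.arrowProdEquivProdArrow (Fin d) (fun _ => S) (fun _ => T))) _ _ fun x => ?_
  rw [AddChar.eq_fstFactor_mul_sndFactor e ψ]
  simp [Prod.fst_sum, Prod.snd_sum, Equiv.arrowProdEquivProdArrow]

end Prod

theorem quadSum_zmod {d : ℕ} (hd : 0 < d) (n : ℕ) [inst : NeZero n] (hn : Squarefree n)
    (ψ : AddChar (ZMod n) ℂ) (hψ : ψ.IsPrimitive) (b : Fin d → ZMod n) :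
    ∃ m : ℤ, quadSum ψ b = n * m := by
  revert inst ψ b
  induction n using Nat.recOnPosPrimePosCoprime with
  | zero => exact absurd hn not_squarefree_zero
  | one =>
    intro _ ψ _ b
    refine ⟨1, ?_⟩
    have h : ∀ z : ZMod 1, ψ z = 1 := fun z => by
      rw [Subsingleton.elim z 0, AddChar.map_zero_eq_one]
    have hu : ∀ k : ZMod 1, IsUnit k := fun k => isUnit_of_subsingleton k
    simp only [quadSum, h, hu]
    simp
  | prime_pow p k hp hk =>
    intro _ ψ hψ b
    obtain rfl : k = 1 := by
      by_contra h
      exact h ((Nat.squarefree_pow_iff hp.ne_one hk.ne').mp hn).2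
    have : Fact (p ^ 1).Prime := ⟨by rwa [pow_one]⟩
    simpa only [ZMod.card] using quadSum_field hψ hd b
  | coprime a c ha hc hac iha ihc =>
    intro _ ψ hψ b
    have : NeZero a := ⟨by omega⟩
    have : NeZero c := ⟨by omega⟩
    have hs := (Nat.squarefree_mul hac).mp hn
    let e := ZMod.chineseRemainder hac
    obtain ⟨m₁, h₁⟩ := iha hs.1 _ (hψ.fstFactor e) (fun i => (e (b i)).1)
    obtain ⟨m₂, h₂⟩ := ihc hs.2 _ (hψ.sndFactor e) (fun i => (e (b i)).2)
    refine ⟨m₁ * m₂, ?_⟩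
    rw [quadSum_eq_mul e, h₁, h₂]
    push_cast
    ring

theorem gsum_eq_quadSum (n d : ℕ) [NeZero n] (b : Fin d → ℤ) :
    gsum n d b = quadSum (ZMod.stdAddChar (N := n)) (fun i => (b i : ZMod n)) := by
  have hen : ∀ z : ℤ, en n z = ZMod.stdAddChar (N := n) (z : ZMod n) := fun z => by
    rw [ZMod.stdAddChar_coe, en]
  have hn : 0 < n := Nat.pos_of_neZero n
  rw [gsum, quadSum]
  refine Finset.sum_nbij' (fun k => (k : ZMod n)) ZMod.val ?_ ?_ ?_ ?_ ?_
  · intro k hk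
    simpa [ZMod.isUnit_iff_coprime] using (Finset.mem_filter.mp hk).2
  · intro k hk
    simp only [Finset.mem_filter] at hk
    rw [← ZMod.natCast_zmod_val k, ZMod.isUnit_iff_coprime] at hk
    simpa [ZMod.val_lt] using hk.2
  · intro k hk
    exact ZMod.val_cast_of_lt (by simpa using (Finset.mem_filter.mp hk).1)
  · intro k _
    exact ZMod.natCast_zmod_val k
  · intro k _
    refine Finset.sum_nbij' (fun x i => (x i : ZMod n)) (fun x i => ((x i).val : ℤ)) ?_ ?_ ?_ ?_ ?_
    · intro x _
      exact Finset.mem_univ _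
    · intro x _
      refine Fintype.mem_piFinset.mpr fun i => Finset.mem_Ico.mpr ⟨Int.natCast_nonneg _, ?_⟩
      exact_mod_cast ZMod.val_lt (x i)
    · intro x hx
      ext i
      have := Finset.mem_Ico.mp (Fintype.mem_piFinset.mp hx i)
      rw [ZMod.val_intCast, Int.emod_eq_of_lt this.1 this.2]
    · intro x _
      ext i
      simp
    · intro x _
      rw [hen]
      push_cast
      rfl

/-- For `n` squarefree even and `d` even, `n ∣ g_n(b)`. -/
theorem gsum_div_squarefree_even (n d : ℕ) (hn : 0 < n) (hsf : Squarefree n) (hev : Even n)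
    (hd : 0 < d) (hdeven : Even d) (b : Fin d → ℤ) :
    ∃ m : ℤ, gsum n d b = n * m := by
  have : NeZero n := ⟨hn.ne'⟩
  rw [gsum_eq_quadSum]
  exact quadSum_zmod hd n hsf _ (ZMod.isPrimitive_stdAddChar n) _
end

section
/- Let n be a positive integer with n ≡ 2 (mod 4), let k be an integer with gcd(k, n) = 1, and let a be an odd integer. Then Σ_{x=0}^{n-1} e_{4n}(k(2x + a)²) = G_{4n}(k)/2, where G_{4n}(k) = Σ_{j=0}^{4n-1} e_{4n}(k j²). -/
open Finset

theorem en_natCast_mul {n : ℕ} (hn : n ≠ 0) (c : ℤ) : en n (n * c) = 1 := by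
  have hn' : (n : ℂ) ≠ 0 := Nat.cast_ne_zero.mpr hn
  unfold en
  rw [Complex.exp_eq_one_iff]
  refine ⟨c, ?_⟩
  push_cast
  field_simp

theorem en_add_natCast_mul {n : ℕ} (hn : n ≠ 0) (x c : ℤ) : en n (x + n * c) = en n x := by
  rw [en_add, en_natCast_mul hn, mul_one]

theorem en_two_mul_mul_odd {h : ℕ} (hh : h ≠ 0) {c : ℤ} (hc : Odd c) :
    en (2 * h) (h * c) = -1 := by
  obtain ⟨d, rfl⟩ := hc
  have hh' : (h : ℂ) ≠ 0 := Nat.cast_ne_zero.mpr hh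
  rw [show (h : ℤ) * (2 * d + 1) = h + (2 * h : ℕ) * d by push_cast; ring,
    en_add_natCast_mul (by positivity)]
  unfold en
  rw [← Complex.exp_pi_mul_I]
  congr 1
  push_cast
  field_simp

theorem sum_range_add_of_periodic {n : ℕ} {f : ℤ → ℂ} (hf : ∀ x, f (x + n) = f x) (b : ℤ) :
    ∑ x ∈ range n, f (x + b) = ∑ x ∈ range n, f x := by
  have step (b : ℤ) : ∑ x ∈ range n, f (x + (b + 1)) = ∑ x ∈ range n, f (x + b) := by
    have h₁ := sum_range_succ (fun x : ℕ => f (x + b)) n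
    have h₂ := sum_range_succ' (fun x : ℕ => f (x + b)) n
    rw [h₁] at h₂
    have h₃ : f (n + b) = f ((0 : ℕ) + b) := by
      rw [add_comm, hf]
      simp
    rw [h₃] at h₂
    rw [add_right_cancel h₂]
    refine sum_congr rfl fun x _ => ?_
    push_cast
    congr 1
    ring
  induction b using Int.induction_on with
  | zero => simp
  | succ i ih => rw [step, ih]
  | pred i ih => rw [← step, sub_add_cancel, ih]

theorem sum_range_two_mul_even_odd (f : ℤ → ℂ) (n : ℕ) :
    ∑ x ∈ range (2 * n), f x = ∑ x ∈ range n, f (2 * x) + ∑ x ∈ range n, f (2 * x + 1) := by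
  induction n with
  | zero => simp
  | succ n ih =>
    rw [show 2 * (n + 1) = 2 * n + 1 + 1 by ring, sum_range_succ, sum_range_succ, ih,
      sum_range_succ, sum_range_succ]
    push_cast
    ring

theorem sum_range_two_mul_of_periodic {n : ℕ} {f : ℤ → ℂ} (hf : ∀ x, f (x + n) = f x) :
    ∑ x ∈ range (2 * n), f x = 2 * ∑ x ∈ range n, f x := by
  rw [two_mul n, sum_range_add, two_mul]
  congr 1
  refine sum_congr rfl fun x _ => ?_
  rw [← hf x]
  push_cast
  rw [add_comm]

theorem sum_range_two_mul_of_antiperiodic {h : ℕ} {f : ℤ → ℂ} (hf : ∀ x, f (x + h) = -f x) :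
    ∑ x ∈ range (2 * h), f x = 0 := by
  rw [two_mul h, sum_range_add, ← sum_add_distrib]
  refine sum_eq_zero fun x _ => ?_
  push_cast
  rw [add_comm (h : ℤ), hf, add_neg_cancel]

/-- For `n ≡ 2 (mod 4)`, `gcd(k,n) = 1` and `a` odd,
`Σ_{x=0}^{n-1} e_{4n}(k(2x+a)²) = G_{4n}(k)/2`. -/
theorem sum_shifted_squares_eq_half_gauss (n : ℕ) (hn : n % 4 = 2) (k : ℤ)
    (hk : Int.gcd k n = 1) (a : ℤ) (ha : Odd a) :
    ∑ x ∈ Finset.range n, en (4 * n) (k * (2 * x + a) ^ 2) = gauss (4 * n) k / 2 := by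
  obtain ⟨h, rfl⟩ : ∃ h, n = 2 * h := ⟨n / 2, by omega⟩
  have hodd : Odd (h : ℤ) := ⟨h / 2, by omega⟩
  have hh : h ≠ 0 := by omega
  have hm : 4 * (2 * h) ≠ 0 := by omega
  have hkodd : Odd k := by
    rw [← Int.not_even_iff_odd, even_iff_two_dvd]
    intro h2
    have := Int.dvd_coe_gcd h2 (show (2 : ℤ) ∣ ((2 * h : ℕ) : ℤ) by simp)
    rw [hk] at this
    norm_num at this
  have hper (x : ℤ) : en (4 * (2 * h)) (k * (2 * (x + (2 * h : ℕ)) + 1) ^ 2) =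
      en (4 * (2 * h)) (k * (2 * x + 1) ^ 2) := by
    rw [← en_add_natCast_mul hm (k * (2 * x + 1) ^ 2) (k * (2 * x + 1 + 2 * h))]
    congr 1
    push_cast
    ring
  have hanti (x : ℤ) : en (4 * (2 * h)) (k * (2 * (x + h)) ^ 2) =
      -en (4 * (2 * h)) (k * (2 * x) ^ 2) := by
    have key : en (4 * (2 * h)) ((4 * h : ℕ) * (k * h)) = -1 := by
      rw [show 4 * (2 * h) = 2 * (4 * h) by ring]
      exact en_two_mul_mul_odd (by omega) (hkodd.mul hodd)
    rw [← mul_neg_one, ← key, ← en_add,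
      ← en_add_natCast_mul hm (k * (2 * x) ^ 2 + _) (k * x)]
    congr 1
    push_cast
    ring
  have heven : ∑ x ∈ range (2 * (2 * h)), en (4 * (2 * h)) (k * (2 * (x : ℤ)) ^ 2) = 0 := by
    have hper' (x : ℤ) : en (4 * (2 * h)) (k * (2 * (x + (2 * h : ℕ))) ^ 2) =
        en (4 * (2 * h)) (k * (2 * x) ^ 2) := by
      rw [← neg_neg (en _ (k * (2 * x) ^ 2)), ← hanti, ← hanti]
      congr 4
      push_cast
      ring
    rw [sum_range_two_mul_of_periodic (f := fun x => en (4 * (2 * h)) (k * (2 * x) ^ 2)) hper',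
      sum_range_two_mul_of_antiperiodic (f := fun x => en (4 * (2 * h)) (k * (2 * x) ^ 2)) hanti,
      mul_zero]
  obtain ⟨b, rfl⟩ := ha
  have hshift := sum_range_add_of_periodic
    (f := fun x => en (4 * (2 * h)) (k * (2 * x + 1) ^ 2)) hper b
  have hsplit := sum_range_two_mul_even_odd
    (fun x => en (4 * (2 * h)) (k * x ^ 2)) (2 * (2 * h))
  have hdouble := sum_range_two_mul_of_periodic
    (f := fun x => en (4 * (2 * h)) (k * (2 * x + 1) ^ 2)) hper
  have hgauss : gauss (4 * (2 * h)) k =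
      2 * ∑ x ∈ range (2 * h), en (4 * (2 * h)) (k * (2 * (x : ℤ) + 1) ^ 2) := by
    rw [← hdouble, ← zero_add (∑ x ∈ range (2 * (2 * h)), _), ← heven, ← hsplit]
    unfold gauss
    rw [show 2 * (2 * (2 * h)) = 4 * (2 * h) by ring]
  rw [hgauss, mul_div_cancel_left₀ _ two_ne_zero, ← hshift]
  refine sum_congr rfl fun x _ => ?_
  congr 2
  ring
end

section
/- For every squarefree positive integer n, every even positive integer d, and every b ∈ ℤ^d, the quantity f_n(b) = Σ_{k=0}^{n-1} Σ_{x ∈ {0,...,n-1}^d} e_n(b·x + k(x·x)) is n times an integer, i.e., there exists m ∈ ℤ with f_n(b) = n·m. -/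
open Finset

/-- `f_n(b) = Σ_{k=0}^{n-1} Σ_{x ∈ {0,…,n-1}^d} e_n(b·x + k(x·x))`. -/
noncomputable def fsum (n d : ℕ) (b : Fin d → ℤ) : ℂ :=
  ∑ k ∈ Finset.range n, ∑ x ∈ Fintype.piFinset fun _ : Fin d => Finset.Ico (0:ℤ) n,
    en n (∑ i, b i * x i + k * ∑ i, x i ^ 2)

/-- The vectors of `{0,…,n-1}^d` that are isotropic modulo `n`. -/
noncomputable def isotropicVectors (n d : ℕ) : Finset (Fin d → ℤ) :=
  (Fintype.piFinset fun _ : Fin d => Finset.Ico (0:ℤ) n).filter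
    fun x => (n : ℤ) ∣ ∑ i, x i ^ 2

theorem mem_isotropicVectors {n d : ℕ} {x : Fin d → ℤ} :
    x ∈ isotropicVectors n d ↔ (∀ i, 0 ≤ x i ∧ x i < n) ∧ (n : ℤ) ∣ ∑ i, x i ^ 2 := by
  simp [isotropicVectors]

theorem zpow_eq_of_pow_eq_one_of_modEq {n : ℕ} {ζ : ℂ} (h0 : ζ ≠ 0) (h : ζ ^ n = 1) {s t : ℤ}
    (hst : s ≡ t [ZMOD n]) : ζ ^ s = ζ ^ t := by
  obtain ⟨c, hc⟩ := hst.dvd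
  obtain rfl : t = s + n * c := by linarith
  rw [zpow_add₀ h0, zpow_mul, zpow_natCast, h, one_zpow, mul_one]

theorem mul_emod_mem_isotropicVectors {n d : ℕ} (hn : 0 < n) (a : ℤ) {x : Fin d → ℤ}
    (hx : x ∈ isotropicVectors n d) : (fun i => a * x i % n) ∈ isotropicVectors n d := by
  have hn' : (0 : ℤ) < n := by exact_mod_cast hn
  rw [mem_isotropicVectors] at hx ⊢
  refine ⟨fun i => ⟨Int.emod_nonneg _ hn'.ne', Int.emod_lt_of_pos _ hn'⟩, ?_⟩
  have h : ∑ i, (a * x i % n) ^ 2 ≡ ∑ i, (a * x i) ^ 2 [ZMOD n] :=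
    Int.ModEq.sum fun i _ => (Int.mod_modEq _ _).pow 2
  rw [h.dvd_iff]
  simp_rw [mul_pow, ← Finset.mul_sum]
  exact hx.2.mul_left _

theorem mul_emod_mul_emod_of_mem {n d : ℕ} {a c : ℤ} (hac : a * c ≡ 1 [ZMOD n])
    {x : Fin d → ℤ} (hx : x ∈ isotropicVectors n d) :
    (fun i => a * (c * x i % n) % n) = x := by
  funext i
  have h : a * (c * x i % n) ≡ x i [ZMOD n] := by
    calc a * (c * x i % n) ≡ a * (c * x i) [ZMOD n] := (Int.mod_modEq _ _).mul_left a
      _ = a * c * x i := by ring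
      _ ≡ 1 * x i [ZMOD n] := hac.mul_right _
      _ = x i := one_mul _
  rw [h.eq]
  have := (mem_isotropicVectors.1 hx).1 i
  exact Int.emod_eq_of_lt this.1 this.2

/-- Scaling by a unit permutes the isotropic vectors, so the character sum over them takes the
same value at every primitive root of unity. -/
theorem sum_isotropicVectors_pow_eq {n d : ℕ} (hn : 0 < n) (b : Fin d → ℤ) {ζ : ℂ}
    (hζ : ζ ^ n = 1) {a : ℕ} (ha : a.Coprime n) :
    ∑ x ∈ isotropicVectors n d, (ζ ^ a) ^ (∑ i, b i * x i) =
      ∑ x ∈ isotropicVectors n d, ζ ^ (∑ i, b i * x i) := by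
  have h0 : ζ ≠ 0 := by
    rintro rfl
    simp [hn.ne'] at hζ
  obtain ⟨c, hc⟩ : ∃ c : ℤ, (a : ℤ) * c ≡ 1 [ZMOD n] :=
    Int.mod_coprime ha
  refine Finset.sum_nbij' (fun x i => a * x i % n) (fun x i => c * x i % n)
    (fun x hx => mul_emod_mem_isotropicVectors hn _ hx)
    (fun x hx => mul_emod_mem_isotropicVectors hn _ hx)
    (fun x hx => mul_emod_mul_emod_of_mem (by rwa [mul_comm]) hx)
    (fun x hx => mul_emod_mul_emod_of_mem hc hx) fun x _ => ?_
  rw [← zpow_natCast, ← zpow_mul]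
  apply zpow_eq_of_pow_eq_one_of_modEq h0 hζ
  rw [Finset.mul_sum]
  refine Int.ModEq.sum fun i _ => ?_
  calc (a : ℤ) * (b i * x i) = b i * (a * x i) := by ring
    _ ≡ b i * (a * x i % n) [ZMOD n] := (Int.mod_modEq _ _).symm.mul_left _

open Polynomial in
/-- An integer polynomial taking the same value at all primitive `n`-th roots of unity takes
an integer value there. -/
theorem exists_int_eq_aeval_of_isPrimitiveRoot {n : ℕ} (hn : 0 < n) (P : ℤ[X]) (s : ℂ)
    (h : ∀ ζ : ℂ, IsPrimitiveRoot ζ n → aeval ζ P = s) : ∃ m : ℤ, s = m := by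
  have hmonic := cyclotomic.monic n ℤ
  set R := P %ₘ cyclotomic n ℤ with hR
  have hdeg : R.degree < n.totient := by
    rw [← degree_cyclotomic n ℤ]
    exact degree_modByMonic_lt _ hmonic
  have hRs : ∀ ζ : ℂ, IsPrimitiveRoot ζ n → aeval ζ R = s := fun ζ hζ => by
    have hroot : aeval ζ (cyclotomic n ℤ) = 0 := by
      rw [aeval_def, eval₂_eq_eval_map, algebraMap_int_eq, map_cyclotomic_int]
      exact hζ.isRoot_cyclotomic hn
    rw [← h ζ hζ, hR, aeval_modByMonic_eq_self_of_root hroot]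
  have hzero : R.map (Int.castRingHom ℂ) - C s = 0 := by
    refine eq_zero_of_degree_lt_of_eval_finset_eq_zero (primitiveRoots n ℂ) ?_ fun ζ hζ => ?_
    · rw [(Complex.isPrimitiveRoot_exp n hn.ne').card_primitiveRoots]
      refine (degree_sub_le _ _).trans_lt (max_lt (degree_map_le.trans_lt hdeg) ?_)
      exact degree_C_le.trans_lt (by exact_mod_cast Nat.totient_pos.2 hn)
    · have := hRs ζ ((mem_primitiveRoots hn).1 hζ)
      rw [aeval_def, eval₂_eq_eval_map, algebraMap_int_eq] at this
      rw [eval_sub, eval_C, this, sub_self]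
  refine ⟨R.coeff 0, ?_⟩
  have := congrArg (coeff · 0) hzero
  simp only [coeff_sub, coeff_map, coeff_C_zero, coeff_zero, eq_intCast] at this
  exact (sub_eq_zero.1 this).symm

theorem exists_int_eq_sum_isotropicVectors {n d : ℕ} (hn : 0 < n) (b : Fin d → ℤ) {ζ : ℂ}
    (hζ : IsPrimitiveRoot ζ n) :
    ∃ m : ℤ, ∑ x ∈ isotropicVectors n d, ζ ^ (∑ i, b i * x i) = m := by
  refine exists_int_eq_aeval_of_isPrimitiveRoot hn
    (∑ x ∈ isotropicVectors n d, Polynomial.X ^ ((∑ i, b i * x i) % n).toNat) _ fun ξ hξ => ?_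
  have : NeZero n := ⟨hn.ne'⟩
  obtain ⟨a, -, ha, rfl⟩ := (hζ.isPrimitiveRoot_iff).1 hξ
  rw [← sum_isotropicVectors_pow_eq hn b hζ.pow_eq_one ha, map_sum]
  refine Finset.sum_congr rfl fun x _ => ?_
  rw [map_pow, Polynomial.aeval_X, ← zpow_natCast _ (Int.toNat _),
    Int.toNat_of_nonneg (Int.emod_nonneg _ (by exact_mod_cast hn.ne'))]
  exact zpow_eq_of_pow_eq_one_of_modEq (hξ.ne_zero hn.ne') hξ.pow_eq_one (Int.mod_modEq _ _)

theorem en_eq_zpow (n : ℕ) (t : ℤ) :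
    en n t = Complex.exp (2 * Real.pi * Complex.I / n) ^ t := by
  rw [en, ← Complex.exp_int_mul]
  congr 1
  ring

theorem sum_range_zpow_mul {n : ℕ} {ζ : ℂ} (hζ : IsPrimitiveRoot ζ n) (q : ℤ) :
    ∑ k ∈ Finset.range n, ζ ^ ((k : ℤ) * q) = if (n : ℤ) ∣ q then (n : ℂ) else 0 := by
  simp_rw [mul_comm _ q, zpow_mul, zpow_natCast]
  split_ifs with h
  · simp [(hζ.zpow_eq_one_iff_dvd q).2 h]
  · have h1 : ζ ^ q ≠ 1 := fun h' => h ((hζ.zpow_eq_one_iff_dvd q).1 h')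
    have hpow : (ζ ^ q) ^ n = 1 := by
      rw [← zpow_natCast, ← zpow_mul, mul_comm, zpow_mul, zpow_natCast, hζ.pow_eq_one, one_zpow]
    rw [geom_sum_eq h1, hpow, sub_self, zero_div]

theorem fsum_eq_mul_sum_isotropicVectors {n : ℕ} (hn : 0 < n) (d : ℕ) (b : Fin d → ℤ) :
    fsum n d b = n * ∑ x ∈ isotropicVectors n d,
      Complex.exp (2 * Real.pi * Complex.I / n) ^ (∑ i, b i * x i) := by
  have hζ := Complex.isPrimitiveRoot_exp n hn.ne'
  rw [fsum, Finset.sum_comm, isotropicVectors, Finset.sum_filter, Finset.mul_sum]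
  refine Finset.sum_congr rfl fun x _ => ?_
  simp_rw [en_eq_zpow, zpow_add₀ (hζ.ne_zero hn.ne'), ← Finset.mul_sum, sum_range_zpow_mul hζ]
  split_ifs <;> ring

/-- For `n` squarefree and `d` even, `n ∣ f_n(b)`. -/
theorem fsum_div_squarefree (n d : ℕ) (hn : 0 < n) (hsf : Squarefree n)
    (hd : 0 < d) (hdeven : Even d) (b : Fin d → ℤ) :
    ∃ m : ℤ, fsum n d b = n * m := by
  obtain ⟨m, hm⟩ :=
    exists_int_eq_sum_isotropicVectors hn b (Complex.isPrimitiveRoot_exp n hn.ne')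
  exact ⟨m, by rw [fsum_eq_mul_sum_isotropicVectors hn, hm]⟩
end
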